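/- No complementary binary morphism of length 3 or of length 6 is cubefree: if h is a uniform binary morphism with h(1) equal to the complement of h(0) and |h(0)| ∈ {3, 6}, then there exists a finite binary word w with ce(w) < 3 such that ce(h(w)) ≥ 3. -/

import Mathlib

/-- The Thue–Morse word: `tm n` is the parity of the number of 1s in the
binary representation of `n` (`true` = letter 1, `false` = letter 0). -/
def tm (n : ℕ) : Bool := ((Nat.digits 2 n).count 1) % 2 == 1

/-- The factor `t[ℓ..ℓ+k-1]` of the Thue–Morse word. -/
def tmFactor (ℓ k : ℕ) : List Bool := (List.range k).map (fun i => tm (ℓ + i))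

/-- Complement of a binary word (exchange 0 and 1 in every position). -/
def wcompl (w : List Bool) : List Bool := w.map (fun b => !b)

/-- Apply the binary morphism `0 ↦ h0, 1 ↦ h1` to the word `w`. -/
def applyMorph (h0 h1 : List Bool) (w : List Bool) : List Bool :=
  (w.map (fun b => bif b then h1 else h0)).flatten

/-- The Thue–Morse morphism μ : 0 ↦ 01, 1 ↦ 10. -/
def mu : List Bool → List Bool := applyMorph [false, true] [true, false]

/-- `p` is a period of the finite word `w`: `1 ≤ p ≤ |w|` and `w[i] = w[i+p]`
for all `i` with `i + p < |w|`. -/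
def HasPeriodW (w : List Bool) (p : ℕ) : Prop :=
  1 ≤ p ∧ p ≤ w.length ∧ ∀ i, i + p < w.length → w.getD i false = w.getD (i + p) false

/-- The smallest period of `w`. -/
noncomputable def per (w : List Bool) : ℕ := sInf {p | HasPeriodW w p}

/-- The exponent of `w`: `|w| / per(w)`. -/
noncomputable def wexp (w : List Bool) : ℝ := (w.length : ℝ) / (per w : ℝ)

/-- The critical exponent of `w`: supremum of exponents of nonempty factors of `w`. -/
noncomputable def ce (w : List Bool) : ℝ :=
  sSup {r : ℝ | ∃ x : List Bool, x ≠ [] ∧ x <:+: w ∧ r = wexp x}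

/-- A `k`-prefix: the length-`k` prefix of the Thue–Morse word, or its complement. -/
def kPrefix (k : ℕ) (s : List Bool) : Prop :=
  s = tmFactor 0 k ∨ s = wcompl (tmFactor 0 k)

/-- `v` is a finite factor of the Thue–Morse word. -/
def IsTMFactor (v : List Bool) : Prop := ∃ ℓ, v = tmFactor ℓ v.length

/-- The complementary morphism `0 ↦ h0, 1 ↦ complement of h0` is cubefree:
it maps every word of critical exponent `< 3` to a word of critical exponent `< 3`. -/
def CubefreeC (h0 : List Bool) : Prop :=
  ∀ w : List Bool, ce w < 3 → ce (applyMorph h0 (wcompl h0) w) < 3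

/-- The word `x` occurs at position `i` of the word `w`. -/
def OccursAt (x w : List Bool) (i : ℕ) : Prop :=
  i + x.length ≤ w.length ∧ (w.drop i).take x.length = x

theorem hasPeriodW_per {x : List Bool} (hx : x ≠ []) : HasPeriodW x (per x) :=
  Nat.sInf_mem (s := {p | HasPeriodW x p})
    ⟨x.length, List.length_pos_iff.mpr hx, le_rfl, fun i hi => by omega⟩

theorem wexp_le_length {x : List Bool} (hx : x ≠ []) : wexp x ≤ x.length := by
  have h : (1 : ℝ) ≤ per x := by exact_mod_cast (hasPeriodW_per hx).1
  exact div_le_self (Nat.cast_nonneg _) h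

theorem bddAbove_wexp (w : List Bool) :
    BddAbove {r : ℝ | ∃ x : List Bool, x ≠ [] ∧ x <:+: w ∧ r = wexp x} := by
  refine ⟨w.length, ?_⟩
  rintro r ⟨x, hx, hxw, rfl⟩
  exact (wexp_le_length hx).trans (by exact_mod_cast hxw.length_le)

theorem hasPeriodW_cube {u : List Bool} (hu : u ≠ []) :
    HasPeriodW (u ++ (u ++ u)) u.length := by
  refine ⟨List.length_pos_iff.mpr hu, by simp, fun i hi => ?_⟩
  simp only [List.length_append] at hi
  rw [List.getD_append_right u (u ++ u) false (i + u.length) (by omega), Nat.add_sub_cancel,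
    ← List.append_assoc, List.getD_append (u ++ u) u false i (by simp; omega)]

/-- A word containing a nonempty cube has critical exponent at least 3. -/
theorem three_le_ce_of_cube {u w : List Bool} (hu : u ≠ []) (h : u ++ (u ++ u) <:+: w) :
    (3 : ℝ) ≤ ce w := by
  have hne : u ++ (u ++ u) ≠ [] := by simp [hu]
  refine le_csSup_of_le (bddAbove_wexp w) ⟨_, hne, h, rfl⟩ ?_
  have hpos : (0 : ℝ) < per (u ++ (u ++ u)) := by exact_mod_cast (hasPeriodW_per hne).1
  have hle : (per (u ++ (u ++ u)) : ℝ) ≤ u.length := by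
    exact_mod_cast Nat.sInf_le (hasPeriodW_cube hu)
  rw [wexp, le_div_iff₀ hpos]
  push_cast [List.length_append]
  linarith

theorem ce_false_false_true_lt_three : ce [false, false, true] < 3 := by
  refine lt_of_le_of_lt (b := (2 : ℝ)) (Real.sSup_le ?_ (by norm_num)) (by norm_num)
  rintro r ⟨x, hx, hxw, rfl⟩
  have hper := hasPeriodW_per hx
  have hpos : (0 : ℝ) < per x := by exact_mod_cast hper.1
  rw [wexp, div_le_iff₀ hpos]
  suffices x.length ≤ 2 * per x by exact_mod_cast this
  have hlen : x.length ≤ 3 := hxw.length_le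
  by_contra! hlt
  have hper1 : per x = 1 := by have := hper.1; omega
  have hx3 : x = [false, false, true] := hxw.eq_of_length (by simp; omega)
  rw [hper1, hx3] at hper
  exact absurd (hper.2.2 1 (by simp)) (by simp)

/-- The image of `001` under any complementary morphism of length 3 or 6 contains a cube. -/
theorem exists_cube_applyMorph (h0 : List Bool) (hlen : h0.length = 3 ∨ h0.length = 6) :
    ∃ i < 12, ∃ p < 5,
      let v := applyMorph h0 (wcompl h0) [false, false, true]
      let u := (v.drop i).take p
      u ≠ [] ∧ u ++ (u ++ u) = (v.drop i).take (3 * p) := by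
  rcases hlen with h | h
  · obtain ⟨a, b, c, rfl⟩ := List.length_eq_three.mp h
    revert a b c
    decide
  · have key : ∀ a b c d e f : Bool, ∃ i < 12, ∃ p < 5,
        let v := applyMorph [a, b, c, d, e, f] (wcompl [a, b, c, d, e, f]) [false, false, true]
        let u := (v.drop i).take p
        u ≠ [] ∧ u ++ (u ++ u) = (v.drop i).take (3 * p) := by
      decide +kernel
    match h0, h with
    | [a, b, c, d, e, f], _ => exact key a b c d e f

/-- no complementary binary morphism of length 3 or 6 is
cubefree. -/
theorem stmt16 (h0 : List Bool) (hlen : h0.length = 3 ∨ h0.length = 6) :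
    ∃ w : List Bool, ce w < 3 ∧ (3 : ℝ) ≤ ce (applyMorph h0 (wcompl h0) w) := by
  obtain ⟨i, -, p, -, hu, hcube⟩ := exists_cube_applyMorph h0 hlen
  refine ⟨[false, false, true], ce_false_false_true_lt_three, three_le_ce_of_cube hu ?_⟩
  rw [hcube]
  exact (List.take_prefix _ _).isInfix.trans (List.drop_suffix _ _).isInfix
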